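/- Let (X,d) be a metric space and let μ be a Borel regular outer measure on X that is doubling with constant C_d ≥ 1, and let s > 1 with s ≥ log₂ C_d. Let σ > 1, let p ≥ s/(s+1), and let B = B(x,r) be a ball in X. Suppose u ∈ L¹(σB), g is a nonnegative μ-measurable function with g ∈ L^p(σB), and there is a set A ⊂ σB with μ(A) = 0 such that |u(x') − u(y')| ≤ d(x',y')·(g(x') + g(y')) for all x', y' ∈ σB∖A. Then ⨍_B |u − u_B| dμ ≤ C·r·(⨍_{σB} g^p dμ)^{1/p}, where the constant C depends only on C_d, p, and σ. -/

import Mathlib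

open Metric MeasureTheory

section Doubling

variable {X : Type*} [PseudoMetricSpace X] [MeasurableSpace X] {μ : Measure X} {C_d : ℝ}

theorem measureReal_ball_two_pow_mul_le (hCd : 0 ≤ C_d)
    (hμ : ∀ (x : X) (r : ℝ), 0 < r → μ.real (ball x (2 * r)) ≤ C_d * μ.real (ball x r))
    (x : X) {r : ℝ} (hr : 0 < r) (n : ℕ) :
    μ.real (ball x (2 ^ n * r)) ≤ C_d ^ n * μ.real (ball x r) := by
  induction n with
  | zero => simp
  | succ n ih =>
    calc μ.real (ball x (2 ^ (n + 1) * r)) = μ.real (ball x (2 * (2 ^ n * r))) := by ring_nf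
      _ ≤ C_d * μ.real (ball x (2 ^ n * r)) := hμ x _ (by positivity)
      _ ≤ C_d * (C_d ^ n * μ.real (ball x r)) := by gcongr
      _ = C_d ^ (n + 1) * μ.real (ball x r) := by ring

/-- If `C_d ^ (1 - p) ≤ 2 ^ p`, a radius shrinking like `2 ^ ((p - 1) * k)` costs at most a factor
`2 ^ (p * k)` of measure. -/
theorem measureReal_ball_le_rpow_mul_measureReal_ball {p : ℝ} (hCd : 1 ≤ C_d)
    (hp1 : p < 1) (hdim : C_d ^ (1 - p) ≤ 2 ^ p)
    (hfin : ∀ (x : X) (r : ℝ), μ (ball x r) ≠ ⊤)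
    (hμ : ∀ (x : X) (r : ℝ), 0 < r → μ.real (ball x (2 * r)) ≤ C_d * μ.real (ball x r))
    {x y : X} {R : ℝ} (hR : 0 < R) (hy : y ∈ ball x R) (k : ℕ) :
    μ.real (ball x R) ≤
      ((2 : ℝ) ^ p) ^ k * μ.real (ball y (4 * R * ((2 : ℝ) ^ (p - 1)) ^ k)) := by
  set n := ⌊(1 - p) * k⌋₊ with hn
  have hk : (0 : ℝ) ≤ (1 - p) * k := mul_nonneg (by linarith) (Nat.cast_nonneg k)
  have hn1 : (n : ℝ) ≤ (1 - p) * k := Nat.floor_le hk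
  have hn2 : (1 - p) * k < n + 1 := Nat.lt_floor_add_one _
  have hpow : C_d ^ n ≤ ((2 : ℝ) ^ p) ^ k := by
    calc C_d ^ n = C_d ^ (n : ℝ) := (Real.rpow_natCast _ _).symm
      _ ≤ C_d ^ ((1 - p) * k) := Real.rpow_le_rpow_of_exponent_le hCd hn1
      _ = (C_d ^ (1 - p)) ^ k := by rw [Real.rpow_mul (by linarith), Real.rpow_natCast]
      _ ≤ ((2 : ℝ) ^ p) ^ k := by gcongr
  have hrad : 2 * R ≤ 2 ^ n * (4 * R * ((2 : ℝ) ^ (p - 1)) ^ k) := by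
    have h1 : (1 : ℝ) ≤ 2 * (2 ^ n * ((2 : ℝ) ^ (p - 1)) ^ k) := by
      rw [← Real.rpow_natCast 2 n, ← Real.rpow_natCast _ k, ← Real.rpow_mul (by norm_num),
        ← Real.rpow_add (by norm_num), ← Real.rpow_one_add' (by norm_num) (by nlinarith)]
      exact Real.one_le_rpow (by norm_num) (by nlinarith)
    nlinarith
  have hsub : ball x R ⊆ ball y (2 ^ n * (4 * R * ((2 : ℝ) ^ (p - 1)) ^ k)) :=
    ball_subset_ball' (by have := mem_ball'.1 hy; linarith)
  calc μ.real (ball x R)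
      ≤ μ.real (ball y (2 ^ n * (4 * R * ((2 : ℝ) ^ (p - 1)) ^ k))) :=
        measureReal_mono hsub (hfin _ _)
    _ ≤ C_d ^ n * μ.real (ball y (4 * R * ((2 : ℝ) ^ (p - 1)) ^ k)) :=
        measureReal_ball_two_pow_mul_le (by linarith) hμ y (by positivity) n
    _ ≤ _ := by gcongr

end Doubling

/-- Chebyshev's inequality for the level `2 ^ k * N`. -/
theorem measureReal_superlevel_lt {X : Type*} [MeasurableSpace X] {μ : Measure X} {S : Set X}
    (hS : MeasurableSet S) (hSfin : μ S ≠ ⊤) {g : X → ℝ} {p N : ℝ} (hp : 0 < p) (hN : 0 < N)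
    (hg : ∀ y, 0 ≤ g y)
    (hgp : IntegrableOn (fun y => g y ^ p) S μ) (hgN : ∫ y in S, g y ^ p ∂μ < N ^ p * μ.real S)
    (k : ℕ) : ((2 : ℝ) ^ p) ^ k * μ.real (S ∩ {y | 2 ^ k * N < g y}) < μ.real S := by
  have hcheb := mul_meas_ge_le_integral_of_nonneg (μ := μ.restrict S)
    (ae_of_all _ fun y => Real.rpow_nonneg (hg y) p) hgp ((2 ^ k * N) ^ p)
  have hle : μ.real (S ∩ {y | 2 ^ k * N < g y}) ≤
      (μ.restrict S).real {y | (2 ^ k * N) ^ p ≤ g y ^ p} := by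
    rw [measureReal_restrict_apply' hS, Set.inter_comm]
    refine measureReal_mono (Set.inter_subset_inter_left _ fun y hy => ?_)
      (measure_ne_top_of_subset Set.inter_subset_right hSfin)
    exact Real.rpow_le_rpow (by positivity) (le_of_lt hy) hp.le
  have hpow : ((2 : ℝ) ^ k * N) ^ p = ((2 : ℝ) ^ p) ^ k * N ^ p := by
    rw [Real.mul_rpow (by positivity) hN.le, ← Real.rpow_natCast, ← Real.rpow_natCast,
      ← Real.rpow_mul (by norm_num), ← Real.rpow_mul (by norm_num), mul_comm (k : ℝ)]
  have hNp : 0 < N ^ p := Real.rpow_pos_of_pos hN p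
  rw [hpow] at hcheb hle
  refine lt_of_mul_lt_mul_left ?_ hNp.le
  calc N ^ p * (((2 : ℝ) ^ p) ^ k * μ.real (S ∩ {y | 2 ^ k * N < g y}))
      = ((2 : ℝ) ^ p) ^ k * N ^ p * μ.real (S ∩ {y | 2 ^ k * N < g y}) := by ring
    _ ≤ _ := by gcongr
    _ ≤ _ := hcheb
    _ < _ := hgN

/-- A chaining argument: if every point can be moved to one with a smaller value of `g` at a
geometrically controlled cost, a function with Hajłasz gradient `g` is bounded by `g ^ p`. -/
theorem abs_sub_le_of_chain {X : Type*} [PseudoMetricSpace X] {x : X} {r σ p N : ℝ} (hr : 0 < r)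
    (hσ : 1 < σ) (hp0 : 0 < p) (hp1 : p < 1) (hN : 0 < N) {u g : X → ℝ} {A : Set X}
    (hg : ∀ y, 0 ≤ g y)
    (hu : ∀ x' ∈ ball x (σ * r) \ A, ∀ y' ∈ ball x (σ * r) \ A,
      |u x' - u y'| ≤ dist x' y' * (g x' + g y'))
    (hstep : ∀ (k : ℕ) (y : X), y ∈ ball x (σ * r) →
      ball y (4 * (σ * r) * ((2 : ℝ) ^ (p - 1)) ^ k) ⊆ ball x (σ * r) →
      ∃ y' ∈ ball y (4 * (σ * r) * ((2 : ℝ) ^ (p - 1)) ^ k), y' ∉ A ∧ g y' ≤ 2 ^ k * N)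
    {k₀ : ℕ} (hk₀ : 4 * σ / (1 - (2 : ℝ) ^ (p - 1)) * ((2 : ℝ) ^ (p - 1)) ^ k₀ ≤ σ - 1)
    {z : X} (hz : z ∈ ball x (σ * r) \ A) (hgz : g z ≤ 2 ^ k₀ * N)
    {y : X} (hy : y ∈ ball x r) (hyA : y ∉ A) :
    |u y - u z| ≤ (16 * σ / ((2 : ℝ) ^ p - 1) + 4 * σ * 2 ^ k₀) * r * N * 2 ^ p *
      (((2 : ℝ) ^ p) ^ k₀ + (g y / N) ^ p) := by
  set l : ℝ := (2 : ℝ) ^ (p - 1) with hl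
  set θ : ℝ := (2 : ℝ) ^ p with hθ
  have hl0 : 0 < l := by positivity
  have hl1 : l < 1 := Real.rpow_lt_one_of_one_lt_of_neg (by norm_num) (by linarith)
  have hθ1 : 1 < θ := Real.one_lt_rpow (by norm_num) hp0
  have hlθ : θ = 2 * l := by
    rw [hθ, hl, Real.rpow_sub_one (by norm_num)]; ring
  set H : ℝ := 4 * σ / (1 - l) with hH
  have hH0 : 0 < H := div_pos (by linarith) (by linarith)
  have hHl : H * (1 - l) = 4 * σ := div_mul_cancel₀ _ (by linarith)
  set K : ℝ := 16 * σ / (θ - 1) + 4 * σ * 2 ^ k₀ with hK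
  have hKθ : 16 * σ ≤ K * (θ - 1) := by
    have : 16 * σ / (θ - 1) * (θ - 1) = 16 * σ := div_mul_cancel₀ _ (by linarith)
    have h2 : 0 ≤ 4 * σ * 2 ^ k₀ * (θ - 1) :=
      mul_nonneg (by positivity) (by linarith)
    rw [hK, add_mul]; linarith
  have hKk : 4 * σ * 2 ^ k₀ ≤ K := by
    have : 0 ≤ 16 * σ / (θ - 1) := div_nonneg (by linarith) (by linarith)
    linarith
  have hK0 : 0 < K := lt_of_lt_of_le (by positivity) hKk
  have hkey : ∀ k, k₀ ≤ k → ∀ y, dist y x < r + H * r * l ^ k → y ∉ A → g y ≤ 2 ^ k * N →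
      |u y - u z| ≤ K * r * N * θ ^ k := by
    intro k hk
    induction k, hk using Nat.le_induction with
    | base =>
      intro y hyd hyA hgy
      have hyB : y ∈ ball x (σ * r) := by rw [mem_ball]; nlinarith
      have hd : dist y z ≤ 2 * (σ * r) := by
        have h1 := dist_triangle_right y z x
        have h2 := mem_ball.1 hyB
        have h3 := mem_ball.1 hz.1
        linarith
      calc |u y - u z| ≤ dist y z * (g y + g z) := hu y ⟨hyB, hyA⟩ z hz
        _ ≤ dist y z * (2 * (2 ^ k₀ * N)) := by gcongr; linarith
        _ ≤ 2 * (σ * r) * (2 * (2 ^ k₀ * N)) := by gcongr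
        _ = (4 * σ * 2 ^ k₀) * r * N * 1 := by ring
        _ ≤ K * r * N * θ ^ k₀ := by
          gcongr
          exact one_le_pow₀ hθ1.le
    | succ k hk ih =>
      intro y hyd hyA hgy
      have hlk : 0 < l ^ k := by positivity
      have hrad : r + H * r * l ^ (k + 1) + 4 * (σ * r) * l ^ k = r + H * r * l ^ k := by
        rw [pow_succ]; linear_combination (-(r * l ^ k)) * hHl
      have hkk : l ^ k ≤ l ^ k₀ := pow_le_pow_of_le_one hl0.le hl1.le hk
      have hle : r + H * r * l ^ k ≤ σ * r := by
        have : H * l ^ k ≤ H * l ^ k₀ := by gcongr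
        nlinarith
      have ht : 0 < 4 * (σ * r) * l ^ k := by positivity
      have hyB : y ∈ ball x (σ * r) := by rw [mem_ball]; linarith
      obtain ⟨y', hy', hyA', hgy'⟩ := hstep k y hyB (ball_subset_ball' (by linarith))
      have hd' : dist y' x < r + H * r * l ^ k := by
        have := dist_triangle y' y x
        have := mem_ball.1 hy'
        linarith
      have hyB' : y' ∈ ball x (σ * r) := by rw [mem_ball]; linarith
      have h1 : |u y - u y'| ≤ 16 * σ * r * N * θ ^ k := by
        calc |u y - u y'| ≤ dist y y' * (g y + g y') := hu y ⟨hyB, hyA⟩ y' ⟨hyB', hyA'⟩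
          _ ≤ dist y y' * (4 * (2 ^ k * N)) := by
            gcongr
            have : (0 : ℝ) < 2 ^ k * N := by positivity
            rw [pow_succ] at hgy; linarith
          _ ≤ 4 * (σ * r) * l ^ k * (4 * (2 ^ k * N)) := by
            gcongr; exact (mem_ball'.1 hy').le
          _ = 16 * σ * r * N * θ ^ k := by rw [hlθ, mul_pow]; ring
      have h2 := ih y' hd' hyA' hgy'
      calc |u y - u z| ≤ |u y - u y'| + |u y' - u z| := abs_sub_le _ _ _
        _ ≤ 16 * σ * r * N * θ ^ k + K * r * N * θ ^ k := add_le_add h1 h2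
        _ ≤ K * (θ - 1) * r * N * θ ^ k + K * r * N * θ ^ k := by gcongr
        _ = K * r * N * θ ^ (k + 1) := by ring
  have hyr : ∀ k, dist y x < r + H * r * l ^ k := fun k => by
    have : 0 < H * r * l ^ k := by positivity
    have := mem_ball.1 hy
    linarith
  have hgp : 0 ≤ (g y / N) ^ p := Real.rpow_nonneg (div_nonneg (hg y) hN.le) p
  by_cases hgy : g y ≤ 2 ^ k₀ * N
  · calc |u y - u z| ≤ K * r * N * θ ^ k₀ := hkey k₀ le_rfl y (hyr k₀) hyA hgy
      _ = K * r * N * 1 * (θ ^ k₀ + 0) := by ring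
      _ ≤ K * r * N * θ * (θ ^ k₀ + (g y / N) ^ p) := by gcongr
  · push Not at hgy
    have hlt : 2 ^ k₀ < g y / N := (lt_div_iff₀ hN).2 hgy
    obtain ⟨n, hn, hn'⟩ := exists_nat_pow_near ((one_le_pow₀ one_le_two).trans hlt.le)
      (one_lt_two (α := ℝ))
    have hkn : k₀ < n + 1 := (pow_lt_pow_iff_right₀ one_lt_two).1 (hlt.trans hn')
    have hpow : θ ^ n ≤ (g y / N) ^ p := by
      have := Real.rpow_le_rpow (by positivity) hn hp0.le
      rwa [← Real.rpow_natCast, ← Real.rpow_mul (by norm_num), mul_comm,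
        Real.rpow_mul (by norm_num), Real.rpow_natCast] at this
    calc |u y - u z| ≤ K * r * N * θ ^ (n + 1) :=
          hkey (n + 1) hkn.le y (hyr _) hyA ((div_le_iff₀ hN).1 hn'.le)
      _ = K * r * N * θ * (0 + θ ^ n) := by ring
      _ ≤ K * r * N * θ * (θ ^ k₀ + (g y / N) ^ p) := by
        gcongr
        positivity

theorem integral_abs_sub_integral_le {Ω : Type*} [MeasurableSpace Ω] {ν : Measure Ω}
    [IsProbabilityMeasure ν] {u : Ω → ℝ} (hu : Integrable u ν) (c : ℝ) :
    ∫ y, |u y - ∫ z, u z ∂ν| ∂ν ≤ 2 * ∫ y, |u y - c| ∂ν := by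
  have hc : Integrable (fun y => |u y - c|) ν := (hu.sub (integrable_const c)).abs
  have hmean : |c - ∫ z, u z ∂ν| ≤ ∫ y, |u y - c| ∂ν := by
    calc |c - ∫ z, u z ∂ν| = |∫ y, (u y - c) ∂ν| := by
          rw [integral_sub hu (integrable_const c), abs_sub_comm]; simp
      _ ≤ _ := abs_integral_le_integral_abs
  calc ∫ y, |u y - ∫ z, u z ∂ν| ∂ν ≤ ∫ y, (|u y - c| + |c - ∫ z, u z ∂ν|) ∂ν :=
        integral_mono (hu.sub (integrable_const _)).abs (hc.add (integrable_const _))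
          fun y => abs_sub_le _ _ _
    _ = (∫ y, |u y - c| ∂ν) + |c - ∫ z, u z ∂ν| := by
        rw [integral_add hc (integrable_const _)]; simp
    _ ≤ _ := by linarith

theorem integrable_rpow_of_le {Ω : Type*} [MeasurableSpace Ω] {ν : Measure Ω}
    [IsFiniteMeasure ν] {g : Ω → ℝ} (hgm : Measurable g) (hg : ∀ y, 0 ≤ g y) {p q : ℝ}
    (hq : 0 ≤ q) (hqp : q ≤ p) (hgp : Integrable (fun y => g y ^ p) ν) :
    Integrable (fun y => g y ^ q) ν := by
  refine (hgp.add (integrable_const 1)).mono' (hgm.pow_const q).aestronglyMeasurable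
    (ae_of_all _ fun y => ?_)
  have hp := Real.rpow_nonneg (hg y) p
  rw [Real.norm_of_nonneg (Real.rpow_nonneg (hg y) q), Pi.add_apply]
  rcases le_total (g y) 1 with h | h
  · linarith [Real.rpow_le_one (hg y) h hq]
  · linarith [Real.rpow_le_rpow_of_exponent_le h hqp]

theorem integral_rpow_rpow_inv_le_of_le {Ω : Type*} [MeasurableSpace Ω] {ν : Measure Ω}
    [IsProbabilityMeasure ν] {g : Ω → ℝ} (hgm : Measurable g) (hg : ∀ y, 0 ≤ g y) {p q : ℝ}
    (hq : 0 < q) (hqp : q ≤ p) (hgp : Integrable (fun y => g y ^ p) ν) :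
    (∫ y, g y ^ q ∂ν) ^ (1 / q) ≤ (∫ y, g y ^ p ∂ν) ^ (1 / p) := by
  have hp : 0 < p := hq.trans_le hqp
  have hpow : ∀ y, (g y ^ q) ^ (p / q) = g y ^ p := fun y => by
    rw [← Real.rpow_mul (hg y), mul_div_cancel₀ _ hq.ne']
  have hI : 0 ≤ ∫ y, g y ^ q ∂ν := integral_nonneg fun y => Real.rpow_nonneg (hg y) q
  have hjensen : (∫ y, g y ^ q ∂ν) ^ (p / q) ≤ ∫ y, (g y ^ q) ^ (p / q) ∂ν :=
    (convexOn_rpow ((one_le_div hq).2 hqp)).map_integral_le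
      (Real.continuous_rpow_const (by positivity)).continuousOn isClosed_Ici
      (ae_of_all _ fun y => Real.rpow_nonneg (hg y) q)
      (integrable_rpow_of_le hgm hg hq.le hqp hgp)
      (by simpa only [Function.comp_def, hpow] using hgp)
  simp only [hpow] at hjensen
  calc (∫ y, g y ^ q ∂ν) ^ (1 / q) = ((∫ y, g y ^ q ∂ν) ^ (p / q)) ^ (1 / p) := by
        rw [← Real.rpow_mul hI]; congr 1; field_simp
    _ ≤ _ := Real.rpow_le_rpow (Real.rpow_nonneg hI _) hjensen (by positivity)

/-- The Poincaré inequality for Hajłasz pairs with an exponent `p < 1`, under the condition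
`C_d ^ (1 - p) ≤ 2 ^ p` on the doubling constant. -/
theorem hajlasz_poincare_of_lt_one (C_d p σ : ℝ) (hCd : 1 ≤ C_d) (hσ : 1 < σ) (hp0 : 0 < p)
    (hp1 : p < 1) (hdim : C_d ^ (1 - p) ≤ 2 ^ p) :
    ∃ C > (0 : ℝ), ∀ (X : Type) [MetricSpace X] [MeasurableSpace X] [BorelSpace X]
      (μ : Measure X),
      (∀ (x : X) (r : ℝ), 0 < r →
        0 < μ (ball x r) ∧ μ (ball x (2 * r)) ≤ ENNReal.ofReal C_d * μ (ball x r) ∧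
          μ (ball x r) < ⊤) →
      ∀ (x : X) (r : ℝ), 0 < r →
      ∀ u g : X → ℝ,
        IntegrableOn u (ball x (σ * r)) μ →
        (∀ y, 0 ≤ g y) →
        IntegrableOn (fun y => g y ^ p) (ball x (σ * r)) μ →
        (∃ A : Set X, A ⊆ ball x (σ * r) ∧ μ A = 0 ∧
          ∀ x' ∈ ball x (σ * r) \ A, ∀ y' ∈ ball x (σ * r) \ A,
            |u x' - u y'| ≤ dist x' y' * (g x' + g y')) →
        ⨍ y in ball x r, |u y - ⨍ z in ball x r, u z ∂μ| ∂μ ≤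
          C * r * (⨍ y in ball x (σ * r), g y ^ p ∂μ) ^ (1 / p) := by
  have hl0 : 0 < (2 : ℝ) ^ (p - 1) := by positivity
  have hl1 : (2 : ℝ) ^ (p - 1) < 1 :=
    Real.rpow_lt_one_of_one_lt_of_neg (by norm_num) (by linarith)
  have hθ1 : 1 < (2 : ℝ) ^ p := Real.one_lt_rpow (by norm_num) hp0
  have hH0 : 0 < 4 * σ / (1 - (2 : ℝ) ^ (p - 1)) := div_pos (by linarith) (by linarith)
  obtain ⟨k₀, hk₀⟩ := exists_pow_lt_of_lt_one (div_pos (sub_pos.2 hσ) hH0) hl1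
  rw [lt_div_iff₀' hH0] at hk₀
  obtain ⟨n₀, hn₀⟩ := pow_unbounded_of_one_lt σ (one_lt_two (α := ℝ))
  set K : ℝ := 16 * σ / ((2 : ℝ) ^ p - 1) + 4 * σ * 2 ^ k₀ with hK
  have hK0 : 0 < K :=
    add_pos (div_pos (by linarith) (by linarith)) (by positivity)
  refine ⟨2 * (K * 2 ^ p * (((2 : ℝ) ^ p) ^ k₀ + C_d ^ n₀)), by positivity, ?_⟩
  intro X _ _ _ μ hμ x r hr u g hu hg hgp ⟨A, hAs, hA0, hA⟩
  have hσr : 0 < σ * r := by positivity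
  have hfin : ∀ (y : X) (t : ℝ), μ (ball y t) ≠ ⊤ := fun y t => by
    rcases le_or_gt t 0 with ht | ht
    · simp [ball_eq_empty.2 ht]
    · exact (hμ y t ht).2.2.ne
  have hpos : ∀ (y : X) (t : ℝ), 0 < t → 0 < μ.real (ball y t) := fun y t ht =>
    ENNReal.toReal_pos (hμ y t ht).1.ne' (hfin y t)
  have hdoub : ∀ (y : X) (t : ℝ), 0 < t → μ.real (ball y (2 * t)) ≤ C_d * μ.real (ball y t) :=
    fun y t ht => by
      have := ENNReal.toReal_mono (ENNReal.mul_ne_top ENNReal.ofReal_ne_top (hfin y t))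
        (hμ y t ht).2.1
      rwa [ENNReal.toReal_mul, ENNReal.toReal_ofReal (by linarith)] at this
  have hsub : ball x r ⊆ ball x (σ * r) := ball_subset_ball (by nlinarith)
  have hBpos := hpos x r hr
  have hSpos := hpos x (σ * r) hσr
  have hI0 : 0 ≤ ∫ y in ball x (σ * r), g y ^ p ∂μ :=
    integral_nonneg fun y => Real.rpow_nonneg (hg y) p
  have hM0 : 0 ≤ ⨍ y in ball x (σ * r), g y ^ p ∂μ := by
    rw [setAverage_eq]; exact mul_nonneg (by positivity) hI0
  have : IsFiniteMeasure (μ.restrict (ball x r)) := isFiniteMeasure_restrict.2 (hfin x r)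
  have : NeZero (μ.restrict (ball x r)) :=
    ⟨fun h => (hμ x r hr).1.ne' (Measure.restrict_eq_zero.1 h)⟩
  refine le_of_forall_gt_imp_ge_of_dense fun b hb => ?_
  set M : ℝ := (⨍ y in ball x (σ * r), g y ^ p ∂μ) ^ (1 / p) with hM
  set C : ℝ := 2 * (K * 2 ^ p * (((2 : ℝ) ^ p) ^ k₀ + C_d ^ n₀)) with hC
  have hC0 : 0 < C * r := by positivity
  obtain ⟨N, rfl⟩ : ∃ N, b = C * r * N := ⟨b / (C * r), (mul_div_cancel₀ _ hC0.ne').symm⟩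
  have hMN : M < N := lt_of_mul_lt_mul_left hb hC0.le
  have hN : 0 < N := (Real.rpow_nonneg hM0 _).trans_lt hMN
  have hNp : 0 < N ^ p := Real.rpow_pos_of_pos hN p
  have hgN : ∫ y in ball x (σ * r), g y ^ p ∂μ < N ^ p * μ.real (ball x (σ * r)) := by
    have h := Real.rpow_lt_rpow (Real.rpow_nonneg hM0 _) hMN hp0
    rw [← Real.rpow_mul hM0, one_div_mul_cancel hp0.ne', Real.rpow_one, setAverage_eq,
      smul_eq_mul, inv_mul_lt_iff₀ hSpos] at h
    linarith
  have hcheb := measureReal_superlevel_lt measurableSet_ball (hfin x (σ * r)) hp0 hN hg hgp hgN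
  have hmeet : ∀ (k : ℕ) (s : Set X), s ⊆ ball x (σ * r) →
      μ.real (ball x (σ * r)) ≤ ((2 : ℝ) ^ p) ^ k * μ.real s →
      ∃ y ∈ s, y ∉ A ∧ g y ≤ 2 ^ k * N := by
    intro k s hs hle
    by_contra! hcon
    have hss : s ⊆ (ball x (σ * r) ∩ {y | 2 ^ k * N < g y}) ∪ A := fun y hy => by
      by_cases hyA : y ∈ A
      · exact Or.inr hyA
      · exact Or.inl ⟨hs hy, hcon y hy hyA⟩
    have h1 : μ.real s ≤ μ.real (ball x (σ * r) ∩ {y | 2 ^ k * N < g y}) := by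
      have hA0' : μ.real A = 0 := by simp [measureReal_def, hA0]
      calc μ.real s ≤ μ.real ((ball x (σ * r) ∩ {y | 2 ^ k * N < g y}) ∪ A) :=
            measureReal_mono hss (measure_ne_top_of_subset
              (Set.union_subset Set.inter_subset_left hAs) (hfin x (σ * r)))
        _ ≤ _ := measureReal_union_le _ _
        _ = _ := by rw [hA0', add_zero]
    have h2 : ((2 : ℝ) ^ p) ^ k * μ.real s ≤
      ((2 : ℝ) ^ p) ^ k * μ.real (ball x (σ * r) ∩ {y | 2 ^ k * N < g y}) := by gcongr
    linarith [hcheb k]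
  obtain ⟨z, hzS, hzA, hgz⟩ := hmeet k₀ _ subset_rfl
    (le_mul_of_one_le_left hSpos.le (one_le_pow₀ hθ1.le))
  have hpt : ∀ y ∈ ball x r, y ∉ A →
      |u y - u z| ≤ K * r * N * 2 ^ p * (((2 : ℝ) ^ p) ^ k₀ + (g y / N) ^ p) := fun y hy hyA =>
    abs_sub_le_of_chain hr hσ hp0 hp1 hN hg hA
      (fun k y hy hs => hmeet k _ hs
        (measureReal_ball_le_rpow_mul_measureReal_ball hCd hp1 hdim hfin hdoub hσr hy k))
      hk₀.le ⟨hzS, hzA⟩ hgz hy hyA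
  have huB : IntegrableOn u (ball x r) μ := hu.mono_set hsub
  have hgB : IntegrableOn (fun y => g y ^ p) (ball x r) μ := hgp.mono_set hsub
  have hconst : ∀ c : ℝ, IntegrableOn (fun _ => c) (ball x r) μ := fun c =>
    integrableOn_const (hfin x r)
  have hgNB : IntegrableOn (fun y => (g y / N) ^ p) (ball x r) μ :=
    (hgB.div_const (N ^ p)).congr
      (ae_of_all _ fun y => (Real.div_rpow (hg y) hN.le p).symm)
  have hSB : μ.real (ball x (σ * r)) ≤ C_d ^ n₀ * μ.real (ball x r) :=
    (measureReal_mono (ball_subset_ball (by gcongr)) (hfin _ _)).trans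
      (measureReal_ball_two_pow_mul_le (by linarith) hdoub x hr n₀)
  have hgint : ∫ y in ball x r, (g y / N) ^ p ∂μ ≤ C_d ^ n₀ * μ.real (ball x r) := by
    calc ∫ y in ball x r, (g y / N) ^ p ∂μ = (∫ y in ball x r, g y ^ p ∂μ) / N ^ p := by
          simp_rw [fun y => Real.div_rpow (hg y) hN.le p, integral_div]
      _ ≤ (∫ y in ball x (σ * r), g y ^ p ∂μ) / N ^ p := by
          refine div_le_div_of_nonneg_right ?_ hNp.le
          exact setIntegral_mono_set hgp (ae_of_all _ fun y => Real.rpow_nonneg (hg y) p)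
            hsub.eventuallyLE
      _ ≤ μ.real (ball x (σ * r)) := by rw [div_le_iff₀ hNp]; linarith
      _ ≤ _ := hSB
  have hosc : ∫ y in ball x r, |u y - u z| ∂μ ≤
      K * r * N * 2 ^ p * (((2 : ℝ) ^ p) ^ k₀ + C_d ^ n₀) * μ.real (ball x r) := by
    calc ∫ y in ball x r, |u y - u z| ∂μ
        ≤ ∫ y in ball x r, K * r * N * 2 ^ p * (((2 : ℝ) ^ p) ^ k₀ + (g y / N) ^ p) ∂μ := by
          refine setIntegral_mono_ae_restrict (huB.sub (hconst _)).abs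
            (((hconst _).add hgNB).const_mul _) ?_
          have hAae : ∀ᵐ y ∂μ, y ∉ A := measure_eq_zero_iff_ae_notMem.1 hA0
          filter_upwards [ae_restrict_mem measurableSet_ball, ae_restrict_of_ae hAae]
            with y hy hyA using hpt y hy hyA
      _ = K * r * N * 2 ^ p *
          (μ.real (ball x r) * ((2 : ℝ) ^ p) ^ k₀ + ∫ y in ball x r, (g y / N) ^ p ∂μ) := by
          rw [integral_const_mul, integral_add (hconst _) hgNB, setIntegral_const, smul_eq_mul]
      _ ≤ K * r * N * 2 ^ p *
          (μ.real (ball x r) * ((2 : ℝ) ^ p) ^ k₀ + C_d ^ n₀ * μ.real (ball x r)) := by gcongr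
      _ = _ := by ring
  calc ⨍ y in ball x r, |u y - ⨍ z in ball x r, u z ∂μ| ∂μ
      ≤ 2 * ⨍ y in ball x r, |u y - u z| ∂μ :=
        integral_abs_sub_integral_le (Integrable.to_average huB) (u z)
    _ = 2 * ((μ.real (ball x r))⁻¹ * ∫ y in ball x r, |u y - u z| ∂μ) := by
        rw [setAverage_eq, smul_eq_mul]
    _ ≤ 2 * ((μ.real (ball x r))⁻¹ *
        (K * r * N * 2 ^ p * (((2 : ℝ) ^ p) ^ k₀ + C_d ^ n₀) * μ.real (ball x r))) := by gcongr
    _ = C * r * N := by rw [hC]; field_simp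

theorem rpow_one_sub_le_two_rpow {C_d s p : ℝ} (hCd : 0 < C_d) (hs : 0 < s) (hp1 : p ≤ 1)
    (hlog : Real.logb 2 C_d ≤ s) (hsp : s / (s + 1) ≤ p) : C_d ^ (1 - p) ≤ 2 ^ p := by
  have hCs : C_d ≤ 2 ^ s := (Real.logb_le_iff_le_rpow (by norm_num) hCd).1 hlog
  rw [div_le_iff₀ (by linarith)] at hsp
  calc C_d ^ (1 - p) ≤ ((2 : ℝ) ^ s) ^ (1 - p) :=
        Real.rpow_le_rpow hCd.le hCs (by linarith)
    _ = 2 ^ (s * (1 - p)) := (Real.rpow_mul (by norm_num) _ _).symm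
    _ ≤ 2 ^ p := Real.rpow_le_rpow_of_exponent_le (by norm_num) (by linarith)


/-- Poincaré inequality for Hajłasz pairs: there is a constant `C`
depending only on `C_d`, `p` and `σ` such that on any metric space with a doubling
Borel regular measure with constant `C_d` and homogeneous dimension `s > 1`,
`s ≥ log₂ C_d`, and for `p ≥ s/(s+1)`, any `u ∈ L¹(σB)` with a nonnegative measurable
`g ∈ L^p(σB)` satisfying the Hajłasz inequality on `σB` off a null set `A` satisfies
`⨍_B |u - u_B| dμ ≤ C r (⨍_{σB} g^p dμ)^(1/p)`. -/
theorem hajlasz_poincare (C_d p σ : ℝ) (hCd : 1 ≤ C_d) (hσ : 1 < σ) :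
    ∃ C > (0 : ℝ), ∀ (X : Type) [MetricSpace X] [MeasurableSpace X] [BorelSpace X]
      (μ : Measure X),
      (∀ (x : X) (r : ℝ), 0 < r →
        0 < μ (ball x r) ∧ μ (ball x (2 * r)) ≤ ENNReal.ofReal C_d * μ (ball x r) ∧
          μ (ball x r) < ⊤) →
      ∀ s : ℝ, 1 < s → Real.logb 2 C_d ≤ s → s / (s + 1) ≤ p →
      ∀ (x : X) (r : ℝ), 0 < r →
      ∀ u g : X → ℝ,
        IntegrableOn u (ball x (σ * r)) μ →
        Measurable g → (∀ y, 0 ≤ g y) →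
        IntegrableOn (fun y => g y ^ p) (ball x (σ * r)) μ →
        (∃ A : Set X, A ⊆ ball x (σ * r) ∧ μ A = 0 ∧
          ∀ x' ∈ ball x (σ * r) \ A, ∀ y' ∈ ball x (σ * r) \ A,
            |u x' - u y'| ≤ dist x' y' * (g x' + g y')) →
        ⨍ y in ball x r, |u y - ⨍ z in ball x r, u z ∂μ| ∂μ ≤
          C * r * (⨍ y in ball x (σ * r), g y ^ p ∂μ) ^ (1 / p) := by
  by_cases hex : ∃ s : ℝ, 1 < s ∧ Real.logb 2 C_d ≤ s ∧ s / (s + 1) ≤ p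
  swap
  · refine ⟨1, one_pos, fun X _ _ _ μ _ s hs hlog hsp => ?_⟩
    exact absurd ⟨s, hs, hlog, hsp⟩ hex
  obtain ⟨s, hs, hlog, hsp⟩ := hex
  obtain ⟨q, hq0, hq1, hqp, hdim⟩ :
      ∃ q : ℝ, 0 < q ∧ q < 1 ∧ q ≤ p ∧ C_d ^ (1 - q) ≤ 2 ^ q := by
    have hq1 : s / (s + 1) < 1 := (div_lt_one (by linarith)).2 (by linarith)
    exact ⟨s / (s + 1), by positivity, hq1, hsp,
      rpow_one_sub_le_two_rpow (by linarith) (by linarith) hq1.le hlog le_rfl⟩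
  obtain ⟨C, hC, H⟩ := hajlasz_poincare_of_lt_one C_d q σ hCd hσ hq0 hq1 hdim
  refine ⟨C, hC, fun X _ _ _ μ hμ _ _ _ _ x r hr u g hu hgm hg hgp hA => ?_⟩
  have hσr : 0 < σ * r := by positivity
  have : IsFiniteMeasure (μ.restrict (ball x (σ * r))) :=
    isFiniteMeasure_restrict.2 (hμ x _ hσr).2.2.ne
  have : NeZero (μ.restrict (ball x (σ * r))) :=
    ⟨fun h => (hμ x _ hσr).1.ne' (Measure.restrict_eq_zero.1 h)⟩
  refine (H X μ hμ x r hr u g hu hg (integrable_rpow_of_le hgm hg hq0.le hqp hgp) hA).trans ?_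
  gcongr
  exact integral_rpow_rpow_inv_le_of_le hgm hg hq0 hqp (Integrable.to_average hgp)
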